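/- arXiv:2507.01181 — 3 statements merged into one kernel-verified Lean document; each statement's English description precedes it below -/
import Mathlib

section
/- Let A and B be regular convex subsets of ℝⁿ with A ∩ B = ∅, let E_A be a k-P2S function for A and E_B a k-P2S function for B, and let F := Π_A ∘ Π_B. Then there exists a unique point a* ∈ ℝⁿ with F(a*) = a*, and for every initial condition a₀ ∈ ℝⁿ the sequence of iterates a_{m+1} = F(a_m), a_0 = a₀, converges to a*. -/
open scoped RealInnerProductSpace

/-- A set is regular if it is compact and has nonempty interior. -/
def IsRegularSet {n : ℕ} (S : Set (EuclideanSpace ℝ (Fin n))) : Prop :=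
  IsCompact S ∧ (interior S).Nonempty

/-- `f` is a k-th order generalized point-to-set half squared metric (k-P2S) for `S`:
(1) nonnegativity; (2) twice differentiable everywhere with Hessian `0 < ∇²f(p) < I`
off `S` and `∇²f(p) = 0` on `S`; (3) `f` is `k` times continuously differentiable;
(4) `f p = 0 ↔ p ∈ S`. -/
structure IsKP2S {n : ℕ} (k : ℕ) (S : Set (EuclideanSpace ℝ (Fin n)))
    (f : EuclideanSpace ℝ (Fin n) → ℝ) : Prop where
  nonneg : ∀ p, 0 ≤ f p
  twice_diff : Differentiable ℝ f ∧ Differentiable ℝ (fderiv ℝ f)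
  hess_posdef : ∀ p ∉ S, ∀ v, v ≠ 0 → 0 < fderiv ℝ (fderiv ℝ f) p v v
  hess_lt_id : ∀ p ∉ S, ∀ v, v ≠ 0 → fderiv ℝ (fderiv ℝ f) p v v < ‖v‖ ^ 2
  hess_zero : ∀ p ∈ S, fderiv ℝ (fderiv ℝ f) p = 0
  contDiff : ContDiff ℝ k f
  zero_iff : ∀ p, f p = 0 ↔ p ∈ S

/-- The generalized projection associated with a point-to-set metric `f`. -/
noncomputable def genProj {n : ℕ} (f : EuclideanSpace ℝ (Fin n) → ℝ)
    (p : EuclideanSpace ℝ (Fin n)) : EuclideanSpace ℝ (Fin n) :=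
  p - gradient f p

open Filter Topology

namespace IsKP2S

variable {n k : ℕ} {S : Set (EuclideanSpace ℝ (Fin n))} {f : EuclideanSpace ℝ (Fin n) → ℝ}

lemma hess_nonneg (hf : IsKP2S k S f) (p v : EuclideanSpace ℝ (Fin n)) :
    0 ≤ fderiv ℝ (fderiv ℝ f) p v v := by
  by_cases hp : p ∈ S
  · simp [hf.hess_zero p hp]
  · rcases eq_or_ne v 0 with rfl | hv
    · simp
    · exact (hf.hess_posdef p hp v hv).le

lemma hess_le (hf : IsKP2S k S f) (p v : EuclideanSpace ℝ (Fin n)) :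
    fderiv ℝ (fderiv ℝ f) p v v ≤ ‖v‖ ^ 2 := by
  by_cases hp : p ∈ S
  · simp [hf.hess_zero p hp]
  · rcases eq_or_ne v 0 with rfl | hv
    · simp
    · exact (hf.hess_lt_id p hp v hv).le

lemma hess_symm (hf : IsKP2S k S f) (p v w : EuclideanSpace ℝ (Fin n)) :
    fderiv ℝ (fderiv ℝ f) p v w = fderiv ℝ (fderiv ℝ f) p w v :=
  second_derivative_symmetric (fun y => (hf.twice_diff.1 y).hasFDerivAt)
    (hf.twice_diff.2 p).hasFDerivAt v w

/-- Mean value theorem for a component of the gradient along a segment. -/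
lemma exists_inner_gradient_sub_eq (hf : IsKP2S k S f) (y v u : EuclideanSpace ℝ (Fin n)) :
    ∃ t ∈ Set.Ioo (0 : ℝ) 1, ⟪gradient f (y + v) - gradient f y, u⟫ =
      fderiv ℝ (fderiv ℝ f) (y + t • v) v u := by
  have hder : ∀ t : ℝ, HasDerivAt (fun t : ℝ => fderiv ℝ f (y + t • v) u)
      (fderiv ℝ (fderiv ℝ f) (y + t • v) v u) t := by
    intro t
    have h1 : HasDerivAt (fun t : ℝ => y + t • v) v t := by
      simpa using ((hasDerivAt_id t).smul_const v).const_add y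
    have h2 := (hf.twice_diff.2 (y + t • v)).hasFDerivAt.comp_hasDerivAt t h1
    simpa using h2.clm_apply (hasDerivAt_const t u)
  obtain ⟨t, ht, h⟩ := exists_hasDerivAt_eq_slope _ _ zero_lt_one
    (fun t _ => (hder t).continuousAt.continuousWithinAt) (fun t _ => hder t)
  refine ⟨t, ht, ?_⟩
  rw [h]
  simp [gradient, inner_sub_left]

/-- The gradient is cocoercive (firmly nonexpansive). -/
lemma norm_gradient_sub_sq_le (hf : IsKP2S k S f) (x y : EuclideanSpace ℝ (Fin n)) :
    ‖gradient f x - gradient f y‖ ^ 2 ≤ ⟪gradient f x - gradient f y, x - y⟫ := by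
  set h := gradient f x - gradient f y with hh
  obtain ⟨t, -, ht⟩ := hf.exists_inner_gradient_sub_eq y (x - y) (x - y - (2 : ℝ) • h)
  rw [add_sub_cancel, ← hh, inner_sub_right, inner_smul_right, real_inner_self_eq_norm_sq] at ht
  have hpos := hf.hess_nonneg (y + t • (x - y)) (x - y - h)
  have hle := hf.hess_le (y + t • (x - y)) h
  have hsymm := hf.hess_symm (y + t • (x - y)) h (x - y)
  simp only [map_sub, map_smul, sub_apply, smul_eq_mul] at hpos ht hsymm
  linarith

lemma continuous_gradient (hf : IsKP2S k S f) : Continuous (gradient f) :=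
  (InnerProductSpace.toDual ℝ _).symm.continuous.comp hf.twice_diff.2.continuous

lemma gradient_eq_zero (hf : IsKP2S k S f) {p : EuclideanSpace ℝ (Fin n)} (hp : p ∈ S) :
    gradient f p = 0 := by
  have hmin : IsLocalMin f p := Eventually.of_forall fun q => by
    rw [(hf.zero_iff p).2 hp]
    exact hf.nonneg q
  simp [gradient, hmin.fderiv_eq_zero]

lemma genProj_eq_self (hf : IsKP2S k S f) {p : EuclideanSpace ℝ (Fin n)} (hp : p ∈ S) :
    genProj f p = p := by
  simp [genProj, hf.gradient_eq_zero hp]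

/-- If the gradient agrees at two distinct points, each of them lies in `S`. -/
lemma mem_of_gradient_eq (hf : IsKP2S k S f) (hS : IsClosed S)
    {x y : EuclideanSpace ℝ (Fin n)} (hxy : x ≠ y) (h : gradient f x = gradient f y) :
    y ∈ S := by
  have hconst : ∀ s ∈ Set.Ioo (0 : ℝ) 1, gradient f (y + s • (x - y)) = gradient f y := by
    intro s hs
    have h1 := hf.norm_gradient_sub_sq_le (y + s • (x - y)) y
    have h2 := hf.norm_gradient_sub_sq_le x (y + s • (x - y))
    have e1 : y + s • (x - y) - y = s • (x - y) := by abel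
    have e2 : x - (y + s • (x - y)) = (1 - s) • (x - y) := by module
    rw [e1, inner_smul_right] at h1
    rw [e2, inner_smul_right, h, ← neg_sub, inner_neg_left, norm_neg] at h2
    have h3 : 0 ≤ ⟪gradient f (y + s • (x - y)) - gradient f y, x - y⟫ := by
      by_contra! hneg
      nlinarith [sq_nonneg ‖gradient f (y + s • (x - y)) - gradient f y‖, hs.1]
    have h4 : ‖gradient f (y + s • (x - y)) - gradient f y‖ ^ 2 ≤ 0 := by
      nlinarith [hs.2]
    exact sub_eq_zero.1 (norm_eq_zero.1 (pow_eq_zero_iff two_ne_zero |>.1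
      (le_antisymm h4 (sq_nonneg _))))
  by_contra hy
  have hev : ∀ᶠ s in 𝓝 (0 : ℝ), y + s • (x - y) ∉ S := by
    have hc : ContinuousAt (fun s : ℝ => y + s • (x - y)) 0 := by fun_prop
    exact hc.eventually_mem (hS.isOpen_compl.mem_nhds (by simpa using hy))
  obtain ⟨ε, hε, hball⟩ := Metric.eventually_nhds_iff.1 hev
  obtain ⟨s, hs0, hs⟩ := exists_between (lt_min hε one_pos)
  have hsε := hs.trans_le (min_le_left _ _)
  have hs1 := hs.trans_le (min_le_right _ _)
  obtain ⟨t, ht, he⟩ := hf.exists_inner_gradient_sub_eq y (s • (x - y)) (s • (x - y))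
  rw [hconst s ⟨hs0, hs1⟩, sub_self, inner_zero_left, smul_smul] at he
  refine (hf.hess_posdef _ (hball ?_) _
    (smul_ne_zero hs0.ne' (sub_ne_zero.2 hxy))).ne he
  rw [Real.dist_eq, sub_zero, abs_of_pos (mul_pos ht.1 hs0)]
  nlinarith [ht.2]

lemma norm_genProj_sub_sq_le (hf : IsKP2S k S f) (x y : EuclideanSpace ℝ (Fin n)) :
    ‖genProj f x - genProj f y‖ ^ 2 ≤ ‖x - y‖ ^ 2 - ‖gradient f x - gradient f y‖ ^ 2 := by
  have e : genProj f x - genProj f y = (x - y) - (gradient f x - gradient f y) := by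
    simp only [genProj]; abel
  have h := hf.norm_gradient_sub_sq_le x y
  rw [e, norm_sub_sq_real, real_inner_comm]
  linarith

lemma norm_genProj_sub_le (hf : IsKP2S k S f) (x y : EuclideanSpace ℝ (Fin n)) :
    ‖genProj f x - genProj f y‖ ≤ ‖x - y‖ := by
  have h := hf.norm_genProj_sub_sq_le x y
  exact le_of_sq_le_sq (by nlinarith [sq_nonneg ‖gradient f x - gradient f y‖]) (norm_nonneg _)

/-- The generalized projection strictly decreases distances unless both points lie in `S`. -/
lemma mem_of_norm_genProj_sub_ge (hf : IsKP2S k S f) (hS : IsClosed S)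
    {x y : EuclideanSpace ℝ (Fin n)} (hxy : x ≠ y)
    (h : ‖x - y‖ ≤ ‖genProj f x - genProj f y‖) : x ∈ S ∧ y ∈ S := by
  have h1 := hf.norm_genProj_sub_sq_le x y
  have h2 : ‖x - y‖ ^ 2 ≤ ‖genProj f x - genProj f y‖ ^ 2 := by gcongr
  have h3 : gradient f x = gradient f y := sub_eq_zero.1 (norm_eq_zero.1
    (pow_eq_zero_iff two_ne_zero |>.1 (le_antisymm (by linarith) (sq_nonneg _))))
  exact ⟨hf.mem_of_gradient_eq hS hxy.symm h3.symm, hf.mem_of_gradient_eq hS hxy h3⟩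

/-- The gradient has a radial component bounded below far away from `S`. -/
lemma exists_inner_gradient_ge (hf : IsKP2S k S f) (hS : IsCompact S)
    {b : EuclideanSpace ℝ (Fin n)} (hb : b ∈ S) :
    ∃ m > 0, ∃ r > 0, ∀ p, r ≤ ‖p - b‖ → m * ‖p - b‖ ≤ ⟪gradient f p, p - b⟫ := by
  obtain ⟨r, hr, hSr⟩ := hS.isBounded.subset_ball_lt 0 b
  obtain ⟨m, hm, hmin⟩ : ∃ m > 0, ∀ q ∈ Metric.sphere b r, m ≤ ‖gradient f q‖ ^ 2 := by
    rcases (Metric.sphere b r).eq_empty_or_nonempty with he | hne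
    · exact ⟨1, one_pos, by simp [he]⟩
    obtain ⟨q, hq, hmin⟩ := (isCompact_sphere b r).exists_isMinOn hne
      (hf.continuous_gradient.norm.pow 2).continuousOn
    refine ⟨_, ?_, fun q' hq' => hmin hq'⟩
    have hqS : q ∉ S := fun h => (Metric.mem_ball.1 (hSr h)).ne (Metric.mem_sphere.1 hq)
    have hg : gradient f q ≠ 0 := fun h0 => hqS <| hf.mem_of_gradient_eq hS.isClosed
      (ne_of_mem_of_not_mem hb hqS) (by rw [h0, hf.gradient_eq_zero hb])
    exact pow_pos (norm_pos_iff.2 hg) 2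
  refine ⟨m / r, by positivity, r, hr, fun p hp => ?_⟩
  set s := ‖p - b‖ with hs
  have hspos : 0 < s := hr.trans_le hp
  have hq : b + (r / s) • (p - b) ∈ Metric.sphere b r := by
    rw [mem_sphere_iff_norm, add_sub_cancel_left, norm_smul, ← hs, Real.norm_eq_abs,
      abs_of_pos (by positivity), div_mul_cancel₀ _ hspos.ne']
  have h1 := hmin _ hq
  have h2 := hf.norm_gradient_sub_sq_le (b + (r / s) • (p - b)) b
  rw [hf.gradient_eq_zero hb, sub_zero, add_sub_cancel_left, inner_smul_right] at h2
  set q := b + (r / s) • (p - b) with hqdef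
  have h3 : ⟪gradient f q, p - b⟫ ≤ ⟪gradient f p, p - b⟫ := by
    rcases hp.eq_or_lt with heq | hlt
    · have : q = p := by rw [hqdef, heq, div_self hspos.ne']; simp
      rw [this]
    have h4 := hf.norm_gradient_sub_sq_le p q
    have e : p - q = (1 - r / s) • (p - b) := by rw [hqdef]; module
    rw [e, inner_smul_right, inner_sub_left] at h4
    have h5 : 0 < 1 - r / s := sub_pos.2 ((div_lt_one hspos).2 hlt)
    have := nonneg_of_mul_nonneg_right ((sq_nonneg _).trans h4) h5
    linarith
  refine le_trans ?_ h3
  have h6 := h1.trans h2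
  rw [div_mul_eq_mul_div, le_div_iff₀ hspos] at h6
  rw [div_mul_eq_mul_div, div_le_iff₀ hr]
  linarith

/-- The generalized projection moves far away points closer to any given point. -/
lemma exists_norm_genProj_sub_le (hf : IsKP2S k S f) (hS : IsCompact S) (hne : S.Nonempty)
    (a : EuclideanSpace ℝ (Fin n)) :
    ∃ R, ∀ p, R ≤ ‖p - a‖ → ‖genProj f p - a‖ ≤ ‖p - a‖ := by
  obtain ⟨b, hb⟩ := hne
  obtain ⟨m, hm, r, -, h⟩ := hf.exists_inner_gradient_ge hS hb
  set D := ‖a - b‖ with hD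
  refine ⟨max r (4 * D ^ 2 / m) + D, fun p hp => ?_⟩
  have htri : ‖p - a‖ ≤ ‖p - b‖ + D := by
    rw [hD, ← norm_neg (a - b), neg_sub]; exact norm_sub_le_norm_sub_add_norm_sub p b a
  have hbig : max r (4 * D ^ 2 / m) ≤ ‖p - b‖ := by linarith
  have h1 := h p ((le_max_left _ _).trans hbig)
  have h2 : 4 * D ^ 2 ≤ m * ‖p - b‖ := by
    have := (le_max_right _ _).trans hbig
    rwa [div_le_iff₀' hm] at this
  have h3 := hf.norm_gradient_sub_sq_le p b
  rw [hf.gradient_eq_zero hb, sub_zero] at h3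
  have h4 : ⟪gradient f p, a - b⟫ ≤ ‖gradient f p‖ * D := real_inner_le_norm _ _
  have e : genProj f p - a = (p - a) - gradient f p := by simp only [genProj]; abel
  have e2 : ⟪gradient f p, p - a⟫ = ⟪gradient f p, p - b⟫ - ⟪gradient f p, a - b⟫ := by
    rw [← inner_sub_right]; congr 1; abel
  refine le_of_sq_le_sq ?_ (norm_nonneg _)
  rw [e, norm_sub_sq_real, real_inner_comm, e2]
  have hD0 : 0 ≤ D := norm_nonneg _
  have hg0 := norm_nonneg (gradient f p)
  rcases le_total (2 * D) ‖gradient f p‖ with hl | hl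
  · nlinarith
  · nlinarith

end IsKP2S

/-- Edelstein's fixed point theorem: a strictly distance-decreasing self-map, each of whose
points lies in an invariant compact set, has a unique globally attracting fixed point. -/
lemma exists_unique_attracting_fixedPoint {X : Type*} [MetricSpace X] [Nonempty X] {F : X → X}
    (hlt : ∀ x y, x ≠ y → dist (F x) (F y) < dist x y)
    (hK : ∀ x, ∃ K, IsCompact K ∧ x ∈ K ∧ Set.MapsTo F K K) :
    ∃ c, F c = c ∧ (∀ a, F a = a → a = c) ∧
      ∀ x, Tendsto (fun m : ℕ => F^[m] x) atTop (𝓝 c) := by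
  have hle : ∀ x y, dist (F x) (F y) ≤ dist x y := by
    intro x y
    rcases eq_or_ne x y with rfl | h
    · simp
    · exact (hlt x y h).le
  have hcont : Continuous F :=
    (LipschitzWith.of_dist_le_mul (K := 1) (by simpa using hle)).continuous
  obtain ⟨c, hc⟩ : ∃ c, F c = c := by
    obtain ⟨K, hKc, hx, hmaps⟩ := hK (Classical.arbitrary X)
    obtain ⟨c, hcK, hmin⟩ := hKc.exists_isMinOn ⟨_, hx⟩ (f := fun x => dist x (F x))
      (by fun_prop)
    refine ⟨c, ?_⟩
    by_contra hne
    exact (hlt c (F c) (Ne.symm hne)).not_ge (hmin (hmaps hcK))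
  refine ⟨c, hc, fun a ha => ?_, fun x => ?_⟩
  · by_contra hne
    have := hlt a c hne
    rw [ha, hc] at this
    exact this.false
  obtain ⟨K, hKc, hx, hmaps⟩ := hK x
  have hstep : ∀ y, dist (F y) c ≤ dist y c := fun y => by simpa [hc] using hle y c
  have hanti : Antitone fun m : ℕ => dist (F^[m] x) c :=
    antitone_nat_of_succ_le fun m => by
      rw [Function.iterate_succ_apply']; exact hstep _
  have hlim := tendsto_atTop_ciInf hanti ⟨0, by rintro _ ⟨m, rfl⟩; exact dist_nonneg⟩
  set d := ⨅ m : ℕ, dist (F^[m] x) c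
  obtain ⟨z, -, φ, hφ, hz⟩ := hKc.tendsto_subseq fun m => hmaps.iterate m hx
  have hd : dist z c = d := tendsto_nhds_unique (hz.dist tendsto_const_nhds)
    (hlim.comp hφ.tendsto_atTop)
  have hFd : dist (F z) c = d := by
    have h1 : Tendsto (fun m => dist (F (F^[φ m] x)) c) atTop (𝓝 (dist (F z) c)) :=
      ((hcont.tendsto z).comp hz).dist tendsto_const_nhds
    have h2 := hlim.comp ((tendsto_add_atTop_nat 1).comp hφ.tendsto_atTop)
    refine tendsto_nhds_unique h1 (h2.congr fun m => ?_)
    simp only [Function.comp_apply, Function.iterate_succ_apply']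
  have hzc : z = c := by
    by_contra hne
    have := hlt z c hne
    rw [hc, hFd, hd] at this
    exact this.false
  rw [tendsto_iff_dist_tendsto_zero]
  rwa [← hd, hzc, dist_self] at hlim

/-- Generalized alternating algorithm: if `A ∩ B = ∅`, the map
`F = Π_A ∘ Π_B` has a unique fixed point `a*`, and the iterates `a_{m+1} = F(a_m)`
converge to `a*` from any initial condition. -/
theorem stmt_2 {n : ℕ} (k : ℕ) (hk : 2 ≤ k)
    (A B : Set (EuclideanSpace ℝ (Fin n)))
    (hAreg : IsRegularSet A) (hAconv : Convex ℝ A)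
    (hBreg : IsRegularSet B) (hBconv : Convex ℝ B)
    (hdisj : A ∩ B = ∅)
    (EA EB : EuclideanSpace ℝ (Fin n) → ℝ)
    (hEA : IsKP2S k A EA) (hEB : IsKP2S k B EB)
    (F : EuclideanSpace ℝ (Fin n) → EuclideanSpace ℝ (Fin n))
    (hF : F = genProj EA ∘ genProj EB) :
    ∃ astar : EuclideanSpace ℝ (Fin n),
      F astar = astar ∧ (∀ a, F a = a → a = astar) ∧
      ∀ a0 : EuclideanSpace ℝ (Fin n),
        Filter.Tendsto (fun m : ℕ => F^[m] a0) Filter.atTop (nhds astar) := by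
  obtain ⟨a, ha⟩ : A.Nonempty := hAreg.2.mono interior_subset
  obtain ⟨R, hR⟩ := hEB.exists_norm_genProj_sub_le hBreg.1 (hBreg.2.mono interior_subset) a
  subst hF
  refine exists_unique_attracting_fixedPoint (fun x y hxy => ?_) fun x => ?_
  · simp only [dist_eq_norm, Function.comp_apply]
    by_contra! hge
    have hA := hEA.norm_genProj_sub_le (genProj EB x) (genProj EB y)
    obtain ⟨hxB, hyB⟩ := hEB.mem_of_norm_genProj_sub_ge hBreg.1.isClosed hxy (hge.trans hA)
    rw [hEB.genProj_eq_self hxB, hEB.genProj_eq_self hyB] at hge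
    have hxA := (hEA.mem_of_norm_genProj_sub_ge hAreg.1.isClosed hxy hge).1
    exact (Set.disjoint_iff_inter_eq_empty.2 hdisj).le_bot ⟨hxA, hxB⟩
  · refine ⟨Metric.closedBall a (max ‖x - a‖ (R + ‖genProj EB a - a‖)),
      isCompact_closedBall _ _, by simp [dist_eq_norm], fun p hp => ?_⟩
    rw [mem_closedBall_iff_norm] at hp ⊢
    have hA := hEA.norm_genProj_sub_le (genProj EB p) a
    rw [hEA.genProj_eq_self ha] at hA
    refine hA.trans ?_
    rcases le_total R ‖p - a‖ with h | h
    · exact (hR p h).trans hp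
    · refine le_trans ?_ (le_max_right _ _)
      have h1 := norm_sub_le_norm_sub_add_norm_sub (genProj EB p) (genProj EB a) a
      linarith [hEB.norm_genProj_sub_le p a]
end

section
/- Let A and B be regular convex subsets of ℝⁿ with A ∩ B = ∅, let E_A be a k-P2S function for A and E_B a k-P2S function for B, let a* be the unique fixed point of F := Π_A ∘ Π_B, and let b* := Π_B(a*). Then the generalized set-to-set half squared metric Λ(a*, b*) = E_A(b*) + E_B(a*) − ‖a* − b*‖²/2 is strictly positive. -/
open scoped RealInnerProductSpace

/-- Descent inequality: a function whose Hessian is bounded by the identity lies below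
its quadratic upper model. -/
theorem le_add_fderiv_add_half_norm_sq_of_hessian_le
    {V : Type*} [NormedAddCommGroup V] [NormedSpace ℝ V] {f : V → ℝ}
    (hf : Differentiable ℝ f) (hf' : Differentiable ℝ (fderiv ℝ f))
    (hess : ∀ p v, fderiv ℝ (fderiv ℝ f) p v v ≤ ‖v‖ ^ 2) (p v : V) :
    f (p + v) ≤ f p + fderiv ℝ f p v + ‖v‖ ^ 2 / 2 := by
  have hline : ∀ t : ℝ, HasDerivAt (fun t : ℝ => p + t • v) v t := fun t => by
    simpa using ((hasDerivAt_id t).smul_const v).const_add p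
  have hslope : ∀ t : ℝ, HasDerivAt (fun t : ℝ => fderiv ℝ f (p + t • v) v - t * ‖v‖ ^ 2)
      (fderiv ℝ (fderiv ℝ f) (p + t • v) v v - ‖v‖ ^ 2) t := fun t => by
    have hcomp : HasDerivAt (fun t : ℝ => fderiv ℝ f (p + t • v))
        (fderiv ℝ (fderiv ℝ f) (p + t • v) v) t :=
      (hf' (p + t • v)).hasFDerivAt.comp_hasDerivAt t (hline t)
    have happly : HasDerivAt (fun t : ℝ => fderiv ℝ f (p + t • v) v)
        (fderiv ℝ (fderiv ℝ f) (p + t • v) v v) t := by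
      simpa using hcomp.clm_apply (hasDerivAt_const t v)
    exact (happly.sub ((hasDerivAt_id t).mul_const (‖v‖ ^ 2))).congr_deriv (by rw [one_mul])
  have hslope_anti : Antitone (fun t : ℝ => fderiv ℝ f (p + t • v) v - t * ‖v‖ ^ 2) :=
    antitone_of_deriv_nonpos (fun t => (hslope t).differentiableAt) fun t => by
      rw [(hslope t).deriv]
      linarith [hess (p + t • v) v]
  have hgap : ∀ t : ℝ, HasDerivAt
      (fun t : ℝ => f (p + t • v) - t * fderiv ℝ f p v - t ^ 2 * (‖v‖ ^ 2 / 2))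
      (fderiv ℝ f (p + t • v) v - fderiv ℝ f p v - t * ‖v‖ ^ 2) t := fun t => by
    have hcomp : HasDerivAt (fun t : ℝ => f (p + t • v)) (fderiv ℝ f (p + t • v) v) t :=
      (hf (p + t • v)).hasFDerivAt.comp_hasDerivAt t (hline t)
    refine ((hcomp.sub ((hasDerivAt_id t).mul_const (fderiv ℝ f p v))).sub
      ((hasDerivAt_pow 2 t).mul_const (‖v‖ ^ 2 / 2))).congr_deriv ?_
    norm_num
    ring
  have hgap_anti : AntitoneOn
      (fun t : ℝ => f (p + t • v) - t * fderiv ℝ f p v - t ^ 2 * (‖v‖ ^ 2 / 2))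
      (Set.Icc 0 1) := by
    refine antitoneOn_of_deriv_nonpos (convex_Icc 0 1)
      (fun t _ => (hgap t).continuousAt.continuousWithinAt)
      (fun t _ => (hgap t).differentiableAt.differentiableWithinAt) fun t ht => ?_
    rw [interior_Icc] at ht
    have h := hslope_anti ht.1.le
    simp only [zero_smul, add_zero, zero_mul, sub_zero] at h
    rw [(hgap t).deriv]
    linarith
  have h := hgap_anti (Set.left_mem_Icc.2 zero_le_one) (Set.right_mem_Icc.2 zero_le_one)
    zero_le_one
  norm_num at h
  linarith

theorem IsKP2S.hessian_le {n k : ℕ} {S : Set (EuclideanSpace ℝ (Fin n))}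
    {f : EuclideanSpace ℝ (Fin n) → ℝ} (hf : IsKP2S k S f) (p v : EuclideanSpace ℝ (Fin n)) :
    fderiv ℝ (fderiv ℝ f) p v v ≤ ‖v‖ ^ 2 := by
  by_cases hp : p ∈ S
  · simp [hf.hess_zero p hp]
  · rcases eq_or_ne v 0 with rfl | hv
    · simp
    · exact (hf.hess_lt_id p hp v hv).le

theorem IsKP2S.half_norm_gradient_sq_le {n k : ℕ} {S : Set (EuclideanSpace ℝ (Fin n))}
    {f : EuclideanSpace ℝ (Fin n) → ℝ} (hf : IsKP2S k S f) (p : EuclideanSpace ℝ (Fin n)) :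
    ‖gradient f p‖ ^ 2 / 2 ≤ f p := by
  have h := le_add_fderiv_add_half_norm_sq_of_hessian_le hf.twice_diff.1 hf.twice_diff.2
    hf.hessian_le p (-gradient f p)
  have hgrad : fderiv ℝ f p (gradient f p) = ‖gradient f p‖ ^ 2 := by
    rw [← real_inner_self_eq_norm_sq, gradient, InnerProductSpace.toDual_symm_apply]
  rw [map_neg, norm_neg, hgrad] at h
  linarith [hf.nonneg (p + -gradient f p)]

/-- the generalized set-to-set half squared metric `Λ(a*,b*)` is strictly positive when `A ∩ B = ∅`. -/
theorem stmt_9 {n : ℕ} (k : ℕ) (hk : 2 ≤ k)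
    (A B : Set (EuclideanSpace ℝ (Fin n)))
    (hAreg : IsRegularSet A) (hAconv : Convex ℝ A)
    (hBreg : IsRegularSet B) (hBconv : Convex ℝ B)
    (hdisj : A ∩ B = ∅)
    (EA EB : EuclideanSpace ℝ (Fin n) → ℝ)
    (hEA : IsKP2S k A EA) (hEB : IsKP2S k B EB)
    (F : EuclideanSpace ℝ (Fin n) → EuclideanSpace ℝ (Fin n))
    (hF : F = genProj EA ∘ genProj EB)
    (astar bstar : EuclideanSpace ℝ (Fin n))
    (hfix : F astar = astar) (huniq : ∀ a, F a = a → a = astar)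
    (hbstar : bstar = genProj EB astar)
    (Λ : EuclideanSpace ℝ (Fin n) → EuclideanSpace ℝ (Fin n) → ℝ)
    (hΛ : ∀ a b, Λ a b = EA b + EB a - ‖a - b‖ ^ 2 / 2) :
    0 < Λ astar bstar := by
  have hB : gradient EB astar = astar - bstar := by
    rw [hbstar, genProj, sub_sub_cancel]
  have hA : gradient EA bstar = bstar - astar := by
    have h : bstar - gradient EA bstar = astar := by
      rw [hF, Function.comp_apply, ← hbstar] at hfix
      exact hfix
    rw [← h, sub_sub_cancel]
  have hAle := hEA.half_norm_gradient_sq_le bstar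
  have hBle := hEB.half_norm_gradient_sq_le astar
  rw [hA, norm_sub_rev] at hAle
  rw [hB] at hBle
  rw [hΛ]
  rcases eq_or_ne astar bstar with hab | hab
  · rw [← hab, sub_self, norm_zero]
    by_contra hneg
    have hA0 : EA astar = 0 := by linarith [hEA.nonneg astar, hEB.nonneg astar]
    have hB0 : EB astar = 0 := by linarith [hEA.nonneg astar, hEB.nonneg astar]
    exact Set.notMem_empty astar
      (hdisj ▸ ⟨(hEA.zero_iff astar).1 hA0, (hEB.zero_iff astar).1 hB0⟩)
  · have hpos : 0 < ‖astar - bstar‖ ^ 2 := pow_pos (norm_pos_iff.2 (sub_ne_zero.2 hab)) 2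
    linarith
end

section
/- Let S ⊆ ℝⁿ be a regular convex set and let k ≥ 2. Let ρ : ℝⁿ → ℝ be k times continuously differentiable with positive definite Hessian ∇²ρ(p) > 0 for all p and ‖∇²ρ(p)‖ < 1 for all p, with ρ(p) < 0 for every p ∈ S, and such that ∇ρ(p) = 0 implies p ∈ S. Let e : ℝⁿ → ℝ be a weak k-P2S function for S. Then there exist positive scalars ε and σ such that E(p) := ε ρ(p) + sqrt(σ² e(p)² + ε² ρ(p)²) is a k-P2S function for S, i.e., E ≥ 0; 0 < ∇²E(p) < I for p ∉ S and ∇²E(p) = 0 for p ∈ S; E is k times continuously differentiable; and E(p) = 0 if and only if p ∈ S. -/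
open scoped RealInnerProductSpace

/-- A weak k-P2S function: identical to a k-P2S function except that off `S` the
Hessian is only required to be positive semidefinite (still `< I`). -/
structure IsWeakKP2S {n : ℕ} (k : ℕ) (S : Set (EuclideanSpace ℝ (Fin n)))
    (f : EuclideanSpace ℝ (Fin n) → ℝ) : Prop where
  nonneg : ∀ p, 0 ≤ f p
  twice_diff : Differentiable ℝ f ∧ Differentiable ℝ (fderiv ℝ f)
  hess_possemidef : ∀ p ∉ S, ∀ v : EuclideanSpace ℝ (Fin n),
    0 ≤ fderiv ℝ (fderiv ℝ f) p v v
  hess_lt_id : ∀ p ∉ S, ∀ v, v ≠ 0 → fderiv ℝ (fderiv ℝ f) p v v < ‖v‖ ^ 2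
  hess_zero : ∀ p ∈ S, fderiv ℝ (fderiv ℝ f) p = 0
  contDiff : ContDiff ℝ k f
  zero_iff : ∀ p, f p = 0 ↔ p ∈ S

section SecondDerivative

variable {V : Type*} [NormedAddCommGroup V] [NormedSpace ℝ V] {f g : V → ℝ}

theorem ContDiff.differentiable_fderiv_of_two (hf : ContDiff ℝ 2 f) :
    Differentiable ℝ (fderiv ℝ f) :=
  (hf.fderiv_right (m := 1) (by norm_num)).differentiable one_ne_zero

theorem fderiv_fderiv_add_of_contDiff (hf : ContDiff ℝ 2 f) (hg : ContDiff ℝ 2 g) (p : V) :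
    fderiv ℝ (fderiv ℝ fun q => f q + g q) p =
      fderiv ℝ (fderiv ℝ f) p + fderiv ℝ (fderiv ℝ g) p := by
  have h : (fderiv ℝ fun q => f q + g q) = fun q => fderiv ℝ f q + fderiv ℝ g q := by
    funext q
    exact fderiv_fun_add (hf.differentiable two_ne_zero q) (hg.differentiable two_ne_zero q)
  rw [h, fderiv_fun_add (hf.differentiable_fderiv_of_two p) (hg.differentiable_fderiv_of_two p)]

theorem fderiv_fderiv_const_mul_of_contDiff (hf : ContDiff ℝ 2 f) (c : ℝ) (p : V) :
    fderiv ℝ (fderiv ℝ fun q => c * f q) p = c • fderiv ℝ (fderiv ℝ f) p := by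
  have h : (fderiv ℝ fun q => c * f q) = fun q => c • fderiv ℝ f q := by
    funext q
    exact fderiv_const_mul (hf.differentiable two_ne_zero q) c
  rw [h, fderiv_fun_const_smul (hf.differentiable_fderiv_of_two p)]

theorem fderiv_sq_of_contDiff (hf : ContDiff ℝ 2 f) (p : V) :
    fderiv ℝ (fun q => f q ^ 2) p = (2 * f p) • fderiv ℝ f p := by
  have h := ((hf.differentiable two_ne_zero p).hasFDerivAt.pow 2).fderiv
  simpa using h

theorem fderiv_fderiv_sq_apply (hf : ContDiff ℝ 2 f) (p v w : V) :
    fderiv ℝ (fderiv ℝ fun q => f q ^ 2) p v w =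
      2 * (fderiv ℝ f p v * fderiv ℝ f p w + f p * fderiv ℝ (fderiv ℝ f) p v w) := by
  have h : (fderiv ℝ fun q => f q ^ 2) = fun q => (2 * f q) • fderiv ℝ f q :=
    funext (fderiv_sq_of_contDiff hf)
  have h2 := (((hf.differentiable two_ne_zero p).hasFDerivAt.const_mul 2).smul
    (hf.differentiable_fderiv_of_two p).hasFDerivAt).fderiv
  rw [h]
  erw [h2]
  simp
  ring

/-- A real function with nonnegative second derivative lies above its tangent at `0`. -/
theorem add_deriv_zero_le_of_second_deriv_nonneg {φ φ' φ'' : ℝ → ℝ}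
    (h1 : ∀ t, HasDerivAt φ (φ' t) t) (h2 : ∀ t, HasDerivAt φ' (φ'' t) t)
    (h : ∀ t, 0 ≤ φ'' t) : φ 0 + φ' 0 ≤ φ 1 := by
  have hmono : Monotone φ' := monotone_of_hasDerivAt_nonneg h2 h
  obtain ⟨c, hc, hc'⟩ := exists_hasDerivAt_eq_slope φ φ' one_pos
    (fun t _ => (h1 t).continuousAt.continuousWithinAt) fun t _ => h1 t
  have := hmono hc.1.le
  simp only [sub_zero, div_one] at hc'
  linarith

theorem hasDerivAt_comp_line (hf : ContDiff ℝ 2 f) (p v : V) (t : ℝ) :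
    HasDerivAt (fun t : ℝ => f (p + t • v)) (fderiv ℝ f (p + t • v) v) t := by
  have hline : HasDerivAt (fun t : ℝ => p + t • v) v t := by
    simpa using ((hasDerivAt_id t).smul_const v).const_add p
  exact (hf.differentiable two_ne_zero _).hasFDerivAt.comp_hasDerivAt t hline

theorem hasDerivAt_fderiv_comp_line (hf : ContDiff ℝ 2 f) (p v : V) (t : ℝ) :
    HasDerivAt (fun t : ℝ => fderiv ℝ f (p + t • v) v)
      (fderiv ℝ (fderiv ℝ f) (p + t • v) v v) t := by
  have hline : HasDerivAt (fun t : ℝ => p + t • v) v t := by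
    simpa using ((hasDerivAt_id t).smul_const v).const_add p
  have h := (hf.differentiable_fderiv_of_two (p + t • v)).hasFDerivAt.comp_hasDerivAt t hline
  simpa using h.clm_apply (hasDerivAt_const t v)

/-- A `C²` function with nonnegative second derivative lies above its tangents. -/
theorem add_fderiv_le_of_fderiv_fderiv_nonneg (hf : ContDiff ℝ 2 f)
    (h : ∀ p v, 0 ≤ fderiv ℝ (fderiv ℝ f) p v v) (p v : V) :
    f p + fderiv ℝ f p v ≤ f (p + v) := by
  simpa using add_deriv_zero_le_of_second_deriv_nonneg (hasDerivAt_comp_line hf p v)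
    (hasDerivAt_fderiv_comp_line hf p v) fun t => h _ _

/-- The descent lemma for a `C²` function whose second derivative is at most the identity. -/
theorem le_add_fderiv_add_sq_of_fderiv_fderiv_le (hf : ContDiff ℝ 2 f)
    (h : ∀ p v, fderiv ℝ (fderiv ℝ f) p v v ≤ ‖v‖ ^ 2) (p v : V) :
    f (p + v) ≤ f p + fderiv ℝ f p v + ‖v‖ ^ 2 / 2 := by
  have hq (t : ℝ) : HasDerivAt (fun t : ℝ => t ^ 2 * (‖v‖ ^ 2 / 2)) (t * ‖v‖ ^ 2) t := by
    refine ((hasDerivAt_pow 2 t).mul_const (‖v‖ ^ 2 / 2)).congr_deriv ?_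
    simp
    ring
  have hl (t : ℝ) : HasDerivAt (fun t : ℝ => t * ‖v‖ ^ 2) (‖v‖ ^ 2) t := by
    simpa using (hasDerivAt_id t).mul_const (‖v‖ ^ 2)
  have := add_deriv_zero_le_of_second_deriv_nonneg
    (fun t => (hq t).sub (hasDerivAt_comp_line hf p v t))
    (fun t => (hl t).sub (hasDerivAt_fderiv_comp_line hf p v t))
    fun t => sub_nonneg.2 (h _ _)
  simp at this
  linarith

/-- If a `C²` function has second derivative at most the identity and satisfies
`f (p + w) ≥ f p - A - B * ‖w‖` for all `w`, its derivative at `p` is controlled by `A` and `B`. -/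
theorem sq_fderiv_le_of_fderiv_fderiv_le (hf : ContDiff ℝ 2 f)
    (h : ∀ p v, fderiv ℝ (fderiv ℝ f) p v v ≤ ‖v‖ ^ 2) {p : V} {A B : ℝ}
    (hAB : ∀ w, f p - A - B * ‖w‖ ≤ f (p + w)) (v : V) :
    fderiv ℝ f p v ^ 2 ≤ 4 * (A + B ^ 2 / 2) * ‖v‖ ^ 2 := by
  have hquad (t : ℝ) :
      0 ≤ ‖v‖ ^ 2 * (t * t) + fderiv ℝ f p v * t + (A + B ^ 2 / 2) := by
    have h1 := hAB (t • v)
    have h2 := le_add_fderiv_add_sq_of_fderiv_fderiv_le hf h p (t • v)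
    have h3 : ‖t • v‖ ^ 2 = ‖v‖ ^ 2 * (t * t) := by
      rw [norm_smul, mul_pow, Real.norm_eq_abs, sq_abs]
      ring
    rw [map_smul, smul_eq_mul] at h2
    nlinarith [sq_nonneg (B - ‖t • v‖)]
  have := discrim_le_zero hquad
  rw [discrim] at this
  linarith

/-- The derivative of a `C²` function with second derivative between `0` and the identity grows at
most like the square root of the function plus a linear term. -/
theorem exists_sq_fderiv_le_of_convex (hf : ContDiff ℝ 2 f)
    (h0 : ∀ p v, 0 ≤ fderiv ℝ (fderiv ℝ f) p v v)
    (h1 : ∀ p v, fderiv ℝ (fderiv ℝ f) p v v ≤ ‖v‖ ^ 2) (p₀ : V) :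
    ∃ C, 0 ≤ C ∧ ∀ p v, fderiv ℝ f p v ^ 2 ≤ C * (1 + ‖p - p₀‖ + |f p|) * ‖v‖ ^ 2 := by
  set B := ‖fderiv ℝ f p₀‖ with hB
  have hB0 : 0 ≤ B := norm_nonneg _
  refine ⟨4 * (1 + |f p₀| + B + B ^ 2 / 2), by positivity, fun p v => ?_⟩
  have hlow (q : V) : f p₀ - B * ‖q - p₀‖ ≤ f q := by
    have h2 := add_fderiv_le_of_fderiv_fderiv_nonneg hf h0 p₀ (q - p₀)
    have h3 := abs_le.1 ((fderiv ℝ f p₀).le_opNorm (q - p₀))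
    rw [add_sub_cancel] at h2
    linarith [h3.1]
  have key := sq_fderiv_le_of_fderiv_fderiv_le hf h1 (p := p)
    (A := f p - f p₀ + B * ‖p - p₀‖) (B := B) (fun w => by
      have h2 := hlow (p + w)
      have h3 : ‖p + w - p₀‖ ≤ ‖p - p₀‖ + ‖w‖ := by
        rw [add_sub_right_comm]
        exact norm_add_le _ _
      nlinarith [mul_le_mul_of_nonneg_left h3 hB0]) v
  refine key.trans (mul_le_mul_of_nonneg_right ?_ (sq_nonneg _))
  have e1 := le_abs_self (f p)
  have e2 := neg_abs_le (f p₀)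
  have e3 := norm_nonneg (p - p₀)
  have e4 := abs_nonneg (f p₀)
  have e5 := abs_nonneg (f p)
  nlinarith [mul_nonneg e4 e3, mul_nonneg e4 e5, mul_nonneg hB0 e5, mul_nonneg (sq_nonneg B) e3,
    mul_nonneg (sq_nonneg B) e5]

/-- A nonnegative `C²` convex function whose zero set is compact and nonempty grows at least
linearly, so together with any continuous function that does not vanish on the zero set it
dominates `1 + ‖p - p₀‖`. -/
theorem exists_one_add_norm_le_of_convex [ProperSpace V] (hf : ContDiff ℝ 2 f)
    (h0 : ∀ p v, 0 ≤ fderiv ℝ (fderiv ℝ f) p v v) (hnonneg : ∀ p, 0 ≤ f p)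
    (hbdd : Bornology.IsBounded {p | f p = 0}) {p₀ : V} (hp₀ : f p₀ = 0)
    (hg : Continuous g) (hfg : ∀ p, f p = 0 → g p ≠ 0) :
    ∃ K, 0 ≤ K ∧ ∀ p, 1 + ‖p - p₀‖ ≤ K * (f p + |g p|) := by
  obtain ⟨R, hR, hsub⟩ := hbdd.subset_ball_lt 0 p₀
  have hpos (p : V) : 0 < f p + |g p| := by
    rcases (hnonneg p).eq_or_lt with h | h
    · have := abs_pos.2 (hfg p h.symm)
      linarith [hnonneg p]
    · linarith [abs_nonneg (g p)]
  obtain ⟨m, hm, hm'⟩ : ∃ m, 0 < m ∧ ∀ p ∈ Metric.closedBall p₀ R, m ≤ f p + |g p| :=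
    (isCompact_closedBall p₀ R).exists_forall_le' (hf.continuous.add hg.abs).continuousOn
      fun p _ => hpos p
  obtain ⟨c, hc, hc'⟩ : ∃ c, 0 < c ∧ ∀ p ∈ Metric.sphere p₀ R, c ≤ f p := by
    refine (isCompact_sphere p₀ R).exists_forall_le' hf.continuous.continuousOn fun p hp => ?_
    refine (hnonneg p).lt_of_ne' fun h => ?_
    have := hsub h
    rw [Metric.mem_ball, Metric.mem_sphere.1 hp] at this
    exact this.false
  refine ⟨(1 + R) / m + (1 + R) / c, by positivity, fun p => ?_⟩
  rw [add_mul]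
  rcases le_total ‖p - p₀‖ R with h | h
  · have h1 := hm' p (by simpa [dist_eq_norm] using h)
    have h2 : 1 + R ≤ (1 + R) / m * (f p + |g p|) := by
      rw [div_mul_eq_mul_div, le_div_iff₀ hm]
      gcongr
    have h3 : 0 ≤ (1 + R) / c * (f p + |g p|) := mul_nonneg (by positivity) (hpos p).le
    linarith
  · set s := ‖p - p₀‖ with hs
    have hs0 : 0 < s := hR.trans_le h
    set y := p₀ + (R / s) • (p - p₀) with hy
    have hyS : y ∈ Metric.sphere p₀ R := by
      rw [mem_sphere_iff_norm, hy, add_sub_cancel_left, norm_smul, ← hs, Real.norm_eq_abs,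
        abs_of_pos (by positivity)]
      field_simp
    have hcy := hc' y hyS
    have t1 := add_fderiv_le_of_fderiv_fderiv_nonneg hf h0 y (-(R / s) • (p - p₀))
    have t2 := add_fderiv_le_of_fderiv_fderiv_nonneg hf h0 y ((1 - R / s) • (p - p₀))
    have y1 : y + -(R / s) • (p - p₀) = p₀ := by rw [hy]; module
    have y2 : y + (1 - R / s) • (p - p₀) = p := by rw [hy]; module
    rw [y1, hp₀, map_smul, smul_eq_mul] at t1
    rw [y2, map_smul, smul_eq_mul] at t2
    have hu : 0 < R / s := by positivity
    have hu1 : R / s ≤ 1 := (div_le_one hs0).2 h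
    have hgrow : c ≤ R / s * f p := by
      nlinarith [mul_le_mul_of_nonneg_left t1 (sub_nonneg.2 hu1),
        mul_le_mul_of_nonneg_left t2 hu.le]
    rw [div_mul_eq_mul_div, le_div_iff₀ hs0] at hgrow
    have h2 : 1 + s ≤ (1 + R) / c * (f p + |g p|) := by
      rw [div_mul_eq_mul_div, le_div_iff₀ hc]
      have hfp : c ≤ f p := by
        nlinarith
      nlinarith [abs_nonneg (g p)]
    have h3 : 0 ≤ (1 + R) / m * (f p + |g p|) := mul_nonneg (by positivity) (hpos p).le
    linarith

end SecondDerivative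

section SqrtSumSq

theorem cube_mul_add_eq_of_sq_eq {a b r a₁ b₁ r₁ a₂ b₂ r₂ : ℝ} (h0 : r ^ 2 = a ^ 2 + b ^ 2)
    (h1 : r * r₁ = a * a₁ + b * b₁)
    (h2 : r₁ * r₁ + r * r₂ = a₁ * a₁ + a * a₂ + (b₁ * b₁ + b * b₂)) :
    r ^ 3 * (b₂ + r₂) = (a * b₁ - b * a₁) ^ 2 + r ^ 2 * (a * a₂ + (b + r) * b₂) := by
  linear_combination r ^ 2 * h2 - (r * r₁ + a * a₁ + b * b₁) * h1 + (a₁ ^ 2 + b₁ ^ 2) * h0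

theorem add_pos_of_sq_eq {a b r a₁ b₁ r₁ a₂ b₂ r₂ : ℝ} (h0 : r ^ 2 = a ^ 2 + b ^ 2)
    (h1 : r * r₁ = a * a₁ + b * b₁)
    (h2 : r₁ * r₁ + r * r₂ = a₁ * a₁ + a * a₂ + (b₁ * b₁ + b * b₂))
    (hr : 0 < r) (ha : 0 < a) (ha₂ : 0 ≤ a₂) (hb₂ : 0 < b₂) : 0 < b₂ + r₂ := by
  have hbr : 0 < b + r := by
    have := abs_lt_of_sq_lt_sq (a := b) (b := r) (by nlinarith) hr.le
    linarith [(abs_lt.1 this).1]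
  refine pos_of_mul_pos_right (a := r ^ 3) ?_ (by positivity)
  rw [cube_mul_add_eq_of_sq_eq h0 h1 h2]
  positivity

theorem add_le_of_sq_eq {a b r a₁ b₁ r₁ a₂ b₂ r₂ N D : ℝ} (h0 : r ^ 2 = a ^ 2 + b ^ 2)
    (h1 : r * r₁ = a * a₁ + b * b₁)
    (h2 : r₁ * r₁ + r * r₂ = a₁ * a₁ + a * a₂ + (b₁ * b₁ + b * b₂))
    (hr : 0 < r) (ha : 0 ≤ a) (hN : 0 ≤ N) (hD : 0 ≤ D) (ha₂ : a₂ ≤ N) (hb₂ : 0 ≤ b₂)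
    (hb₂' : b₂ ≤ N) (ha₁ : a₁ ^ 2 ≤ 4 * a * N) (hb₁ : b₁ ^ 2 ≤ D * (a + |b|) * N) :
    b₂ + r₂ ≤ (11 + 4 * D) * N := by
  have har : a ≤ r := abs_le_of_sq_le_sq' (by nlinarith) hr.le |>.2
  have hbr : |b| ≤ r := abs_le_of_sq_le_sq (by nlinarith) hr.le
  refine le_of_mul_le_mul_left (a := r ^ 3) ?_ (by positivity)
  rw [cube_mul_add_eq_of_sq_eq h0 h1 h2]
  have hb : b ≤ r := (le_abs_self b).trans hbr
  have hsq : b ^ 2 ≤ r ^ 2 := by nlinarith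
  have hsqa : a ^ 2 ≤ r ^ 2 := by nlinarith
  have s1 : b ^ 2 * a₁ ^ 2 ≤ r ^ 2 * (4 * r * N) :=
    mul_le_mul hsq (ha₁.trans (by gcongr)) (sq_nonneg _) (sq_nonneg _)
  have s2 : a ^ 2 * b₁ ^ 2 ≤ r ^ 2 * (D * (r + r) * N) :=
    mul_le_mul hsqa (hb₁.trans (by gcongr)) (sq_nonneg _) (sq_nonneg _)
  have s3 : a * a₂ ≤ r * N := (mul_le_mul_of_nonneg_left ha₂ ha).trans (by gcongr)
  have s4 : (b + r) * b₂ ≤ (r + r) * N := mul_le_mul (by linarith) hb₂' hb₂ (by linarith)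
  have s5 : r ^ 2 * (a * a₂ + (b + r) * b₂) ≤ r ^ 2 * (r * N + (r + r) * N) := by gcongr
  nlinarith [sq_nonneg (a * b₁ + b * a₁)]

variable {V : Type*} [NormedAddCommGroup V] [NormedSpace ℝ V] {e ρ r : V → ℝ}

theorem mul_fderiv_eq_of_sq_eq (he : ContDiff ℝ 2 e) (hρ : ContDiff ℝ 2 ρ) (hr : ContDiff ℝ 2 r)
    (h : ∀ p, r p ^ 2 = e p ^ 2 + ρ p ^ 2) (p v : V) :
    r p * fderiv ℝ r p v = e p * fderiv ℝ e p v + ρ p * fderiv ℝ ρ p v := by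
  have h1 : fderiv ℝ (fun q => r q ^ 2) p v = fderiv ℝ (fun q => e q ^ 2 + ρ q ^ 2) p v := by
    simp only [h]
  rw [fderiv_fun_add ((he.pow 2).differentiable two_ne_zero p)
    ((hρ.pow 2).differentiable two_ne_zero p), fderiv_sq_of_contDiff he, fderiv_sq_of_contDiff hρ,
    fderiv_sq_of_contDiff hr] at h1
  simp only [add_apply, smul_apply, smul_eq_mul] at h1
  linarith

theorem mul_fderiv_fderiv_eq_of_sq_eq (he : ContDiff ℝ 2 e) (hρ : ContDiff ℝ 2 ρ)
    (hr : ContDiff ℝ 2 r) (h : ∀ p, r p ^ 2 = e p ^ 2 + ρ p ^ 2) (p v w : V) :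
    fderiv ℝ r p v * fderiv ℝ r p w + r p * fderiv ℝ (fderiv ℝ r) p v w =
      fderiv ℝ e p v * fderiv ℝ e p w + e p * fderiv ℝ (fderiv ℝ e) p v w +
      (fderiv ℝ ρ p v * fderiv ℝ ρ p w + ρ p * fderiv ℝ (fderiv ℝ ρ) p v w) := by
  have h1 : fderiv ℝ (fderiv ℝ fun q => r q ^ 2) p v w =
      fderiv ℝ (fderiv ℝ fun q => e q ^ 2 + ρ q ^ 2) p v w := by
    simp only [h]
  rw [fderiv_fderiv_add_of_contDiff (he.pow 2) (hρ.pow 2), add_apply, add_apply,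
    fderiv_fderiv_sq_apply he, fderiv_fderiv_sq_apply hρ, fderiv_fderiv_sq_apply hr] at h1
  linarith

end SqrtSumSq

/-- strict convexification of a weak k-P2S function. Given a `C^k`
strictly convex `ρ` with `‖∇²ρ‖ < 1`, negative on `S`, and whose gradient vanishes
only inside `S`, there exist `ε, σ > 0` so that
`E(p) = ε ρ(p) + √(σ² e(p)² + ε² ρ(p)²)` is a k-P2S function for `S`. -/
theorem stmt_15 {n : ℕ} (k : ℕ) (hk : 2 ≤ k)
    (S : Set (EuclideanSpace ℝ (Fin n)))
    (hSreg : IsRegularSet S) (hSconv : Convex ℝ S)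
    (ρ : EuclideanSpace ℝ (Fin n) → ℝ)
    (hρk : ContDiff ℝ k ρ)
    (hρposdef : ∀ p, ∀ v : EuclideanSpace ℝ (Fin n), v ≠ 0 →
      0 < fderiv ℝ (fderiv ℝ ρ) p v v)
    (hρlt : ∀ p, ‖fderiv ℝ (fderiv ℝ ρ) p‖ < 1)
    (hρneg : ∀ p ∈ S, ρ p < 0)
    (hρgrad : ∀ p, gradient ρ p = 0 → p ∈ S)
    (e : EuclideanSpace ℝ (Fin n) → ℝ)
    (he : IsWeakKP2S k S e) :
    ∃ ε σ : ℝ, 0 < ε ∧ 0 < σ ∧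
      IsKP2S k S (fun p =>
        ε * ρ p + Real.sqrt (σ ^ 2 * e p ^ 2 + ε ^ 2 * ρ p ^ 2)) := by
  have hk' : (2 : WithTop ℕ∞) ≤ k := by exact_mod_cast hk
  have hρ2 : ContDiff ℝ 2 ρ := hρk.of_le hk'
  have he2 : ContDiff ℝ 2 e := he.contDiff.of_le hk'
  have hρ0 (p v : EuclideanSpace ℝ (Fin n)) : 0 ≤ fderiv ℝ (fderiv ℝ ρ) p v v := by
    rcases eq_or_ne v 0 with rfl | hv
    · simp
    · exact (hρposdef p v hv).le
  have hρ1 (p v : EuclideanSpace ℝ (Fin n)) : fderiv ℝ (fderiv ℝ ρ) p v v ≤ ‖v‖ ^ 2 := by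
    refine (le_abs_self _).trans (((fderiv ℝ (fderiv ℝ ρ) p).le_opNorm₂ v v).trans ?_)
    nlinarith [hρlt p, sq_nonneg ‖v‖]
  have he0 (p v : EuclideanSpace ℝ (Fin n)) : 0 ≤ fderiv ℝ (fderiv ℝ e) p v v := by
    by_cases hp : p ∈ S
    · simp [he.hess_zero p hp]
    · exact he.hess_possemidef p hp v
  have he1 (p v : EuclideanSpace ℝ (Fin n)) : fderiv ℝ (fderiv ℝ e) p v v ≤ ‖v‖ ^ 2 := by
    by_cases hp : p ∈ S
    · simp [he.hess_zero p hp]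
    · rcases eq_or_ne v 0 with rfl | hv
      · simp
      · exact (he.hess_lt_id p hp v hv).le
  obtain ⟨p₀, hp₀⟩ := hSreg.2.mono interior_subset
  obtain ⟨C, hC, hCρ⟩ := exists_sq_fderiv_le_of_convex hρ2 hρ0 hρ1 p₀
  obtain ⟨K, hK, hKe⟩ := exists_one_add_norm_le_of_convex he2 he0 he.nonneg
    (by simpa only [he.zero_iff, Set.ofPred_mem_eq] using hSreg.1.isBounded) ((he.zero_iff p₀).2 hp₀)
    hρ2.continuous fun p hp => (hρneg p ((he.zero_iff p).1 hp)).ne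
  have hgρ (p v : EuclideanSpace ℝ (Fin n)) :
      fderiv ℝ ρ p v ^ 2 ≤ C * (K + 1) * (e p + |ρ p|) * ‖v‖ ^ 2 := by
    refine (hCρ p v).trans (mul_le_mul_of_nonneg_right ?_ (sq_nonneg _))
    rw [mul_assoc]
    exact mul_le_mul_of_nonneg_left (by nlinarith [hKe p, he.nonneg p]) hC
  have hge (p v : EuclideanSpace ℝ (Fin n)) : fderiv ℝ e p v ^ 2 ≤ 4 * e p * ‖v‖ ^ 2 := by
    simpa using sq_fderiv_le_of_fderiv_fderiv_le he2 he1 (p := p) (A := e p) (B := 0)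
      (fun w => by simpa using he.nonneg _) v
  have hpos (p : EuclideanSpace ℝ (Fin n)) : 0 < e p ^ 2 + ρ p ^ 2 := by
    by_cases hp : p ∈ S
    · have := sq_pos_of_neg (hρneg p hp)
      positivity
    · have : e p ≠ 0 := fun h => hp ((he.zero_iff p).1 h)
      positivity
  set r : EuclideanSpace ℝ (Fin n) → ℝ := fun p => √(e p ^ 2 + ρ p ^ 2) with hrdef
  have hrk : ContDiff ℝ k r :=
    ((he.contDiff.pow 2).add (hρk.pow 2)).sqrt fun p => (hpos p).ne'
  have hr2 : ContDiff ℝ 2 r := hrk.of_le hk'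
  have hr0 (p : EuclideanSpace ℝ (Fin n)) : 0 < r p := Real.sqrt_pos.2 (hpos p)
  have hrsq (p : EuclideanSpace ℝ (Fin n)) : r p ^ 2 = e p ^ 2 + ρ p ^ 2 :=
    Real.sq_sqrt (hpos p).le
  have hr1 := mul_fderiv_eq_of_sq_eq he2 hρ2 hr2 hrsq
  have hr11 := mul_fderiv_fderiv_eq_of_sq_eq he2 hρ2 hr2 hrsq
  set M := 11 + 4 * (C * (K + 1)) with hM
  have hM0 : 0 < M := by positivity
  set ε := 1 / (M + 1) with hε
  have hε0 : 0 < ε := by positivity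
  have hE : (fun p => ε * ρ p + √(ε ^ 2 * e p ^ 2 + ε ^ 2 * ρ p ^ 2)) =
      fun p => ε * (ρ p + r p) := by
    funext p
    rw [← mul_add (ε ^ 2), Real.sqrt_mul (sq_nonneg ε), Real.sqrt_sq hε0.le, mul_add]
  have hEk : ContDiff ℝ k fun p => ε * (ρ p + r p) := contDiff_const.mul (hρk.add hrk)
  have hE2 : ContDiff ℝ 2 fun p => ε * (ρ p + r p) := hEk.of_le hk'
  have hess (p : EuclideanSpace ℝ (Fin n)) :
      fderiv ℝ (fderiv ℝ fun p => ε * (ρ p + r p)) p =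
        ε • (fderiv ℝ (fderiv ℝ ρ) p + fderiv ℝ (fderiv ℝ r) p) := by
    rw [fderiv_fderiv_const_mul_of_contDiff (hρ2.add hr2), fderiv_fderiv_add_of_contDiff hρ2 hr2]
  refine ⟨ε, ε, hε0, hε0, ?_⟩
  rw [hE]
  refine ⟨fun p => ?_, ⟨hE2.differentiable two_ne_zero, hE2.differentiable_fderiv_of_two⟩,
    fun p hp v hv => ?_, fun p hp v hv => ?_, fun p hp => ?_, hEk, fun p => ?_⟩
  · have := abs_le_of_sq_le_sq' (a := ρ p) (b := r p) (by nlinarith [hrsq p]) (hr0 p).le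
    exact mul_nonneg hε0.le (by linarith [this.1])
  · have hep : 0 < e p := (he.nonneg p).lt_of_ne' fun h => hp ((he.zero_iff p).1 h)
    rw [hess]
    exact mul_pos hε0 (add_pos_of_sq_eq (hrsq p) (hr1 p v) (hr11 p v v) (hr0 p) hep
      (he0 p v) (hρposdef p v hv))
  · have hv' : 0 < ‖v‖ := norm_pos_iff.2 hv
    have hle := add_le_of_sq_eq (hrsq p) (hr1 p v) (hr11 p v v) (hr0 p) (he.nonneg p)
      (sq_nonneg ‖v‖) (by positivity) (he1 p v) (hρ0 p v) (hρ1 p v) (hge p v) (hgρ p v)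
    rw [hess]
    change ε * (fderiv ℝ (fderiv ℝ ρ) p v v + fderiv ℝ (fderiv ℝ r) p v v) < _
    rw [hε, one_div_mul_eq_div, div_lt_iff₀ (by positivity)]
    nlinarith [pow_pos hv' 2]
  · have hep : e p = 0 := (he.zero_iff p).2 hp
    have hrp : r p = -ρ p := by
      rw [hrdef]
      simp only [hep]
      rw [zero_pow two_ne_zero, zero_add, Real.sqrt_sq_eq_abs, abs_of_neg (hρneg p hp)]
    have hρp : ρ p ≠ 0 := (hρneg p hp).ne
    have hep' (v : EuclideanSpace ℝ (Fin n)) : fderiv ℝ e p v = 0 := by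
      have := hge p v
      rw [hep] at this
      exact pow_eq_zero_iff two_ne_zero |>.1 (le_antisymm (by simpa using this) (sq_nonneg _))
    have hrp' (v : EuclideanSpace ℝ (Fin n)) : fderiv ℝ r p v = -fderiv ℝ ρ p v := by
      have := hr1 p v
      rw [hep, hrp] at this
      exact mul_left_cancel₀ hρp (by linarith)
    rw [hess]
    ext v w
    have h2 := hr11 p v w
    rw [hep, hrp, hep', hrp', hrp'] at h2
    have h3 : fderiv ℝ (fderiv ℝ ρ) p v w + fderiv ℝ (fderiv ℝ r) p v w = 0 :=
      mul_left_cancel₀ hρp (by linarith)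
    change ε * (fderiv ℝ (fderiv ℝ ρ) p v w + fderiv ℝ (fderiv ℝ r) p v w) = 0
    rw [h3, mul_zero]
  · rw [mul_eq_zero, or_iff_right hε0.ne', ← he.zero_iff]
    constructor
    · intro h
      have h1 := hrsq p
      rw [eq_neg_of_add_eq_zero_right h, neg_sq] at h1
      exact pow_eq_zero_iff two_ne_zero |>.1 (by linarith)
    · intro h
      have hrp : r p = |ρ p| := by
        rw [hrdef]
        simp only [h]
        rw [zero_pow two_ne_zero, zero_add, Real.sqrt_sq_eq_abs]
      rw [hrp, abs_of_neg (hρneg p ((he.zero_iff p).1 h)), add_neg_cancel]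
end
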